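/- Let d ≥ 2, p > 2, and let q satisfy dp/(p+d−2) < q ≤ p. For every δ > 0 there exists a constant C_δ, depending only on δ, d, p, and q, such that for all u, f ∈ C_c^∞(ℝ^d; ℝ) and every j ∈ {1, …, d}, p |∫_{ℝ^d} |u|^{p−2} u ∂_j f dx| ≤ δ ‖∇(|u|^{p/2})‖_{L²(ℝ^d)}² + δ ‖u‖_{L^p(ℝ^d)}^p + C_δ ‖f‖_{L^q(ℝ^d)}^p. -/

import Mathlib

open MeasureTheory

/-- A real-valued form of the Gagliardo–Nirenberg–Sobolev inequality. -/
theorem exists_integral_rpow_le_integral_fderiv_rpow {d : ℕ} (hd : 0 < d) {r t : ℝ}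
    (hr : 1 ≤ r) (ht : 0 < t) (hrt : t⁻¹ = r⁻¹ - (d : ℝ)⁻¹) :
    ∃ K : ℝ, 0 ≤ K ∧ ∀ w : EuclideanSpace ℝ (Fin d) → ℝ, ContDiff ℝ 1 w → HasCompactSupport w →
      ∫ x, |w x| ^ t ≤ K * (∫ x, ‖fderiv ℝ w x‖ ^ r) ^ (t / r) := by
  have hr0 : 0 < r := by linarith
  lift r to NNReal using hr0.le
  lift t to NNReal using ht.le
  let C := SNormLESNormFDerivOfEqConst ℝ
    (volume : Measure (EuclideanSpace ℝ (Fin d))) r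
  refine ⟨(C : ℝ) ^ (t : ℝ), by positivity, fun w hw hcw => ?_⟩
  have key := eLpNorm_le_eLpNorm_fderiv_of_eq
    (volume : Measure (EuclideanSpace ℝ (Fin d))) hw hcw (p := r) (p' := t)
    (by exact_mod_cast hr) (by simpa using hd) (by simpa using hrt)
  have hw' := hw.continuous_fderiv one_ne_zero
  have hr1 : r ≠ 0 := by rintro rfl; simp at hr0
  have ht1 : t ≠ 0 := by rintro rfl; simp at ht
  rw [(hw.continuous.memLp_of_hasCompactSupport hcw).eLpNorm_eq_integral_rpow_norm
      (by simpa using ht1) (by simp),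
    (hw'.memLp_of_hasCompactSupport (hcw.fderiv ℝ)).eLpNorm_eq_integral_rpow_norm
      (by simpa using hr1) (by simp),
    ← ENNReal.ofReal_coe_nnreal (p := SNormLESNormFDerivOfEqConst _ _ _),
    ← ENNReal.ofReal_mul (by positivity), ENNReal.ofReal_le_ofReal_iff (by positivity)] at key
  simp only [ENNReal.coe_toReal, Real.norm_eq_abs] at key
  have hI : 0 ≤ ∫ x, |w x| ^ (t : ℝ) := by positivity
  have hJ : 0 ≤ ∫ x, ‖fderiv ℝ w x‖ ^ (r : ℝ) := by positivity
  have := Real.rpow_le_rpow (by positivity) key ht.le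
  rwa [← Real.rpow_mul hI, inv_mul_cancel₀ ht.ne', Real.rpow_one,
    Real.mul_rpow (by positivity) (by positivity), ← Real.rpow_mul hJ, inv_mul_eq_div] at this

theorem rpow_le_add_rpow_of_mem_Icc {x l a s b : ℝ} (hx : 0 ≤ x) (hl : 0 < l) (ha : 0 < a)
    (has : a ≤ s) (hsb : s ≤ b) : x ^ s ≤ l ^ (s - a) * x ^ a + l ^ (s - b) * x ^ b := by
  rcases hx.eq_or_lt with rfl | hx
  · rw [Real.zero_rpow (by linarith)]
    positivity
  rcases le_total x l with h | h
  · calc x ^ s = x ^ (s - a) * x ^ a := by rw [← Real.rpow_add hx]; ring_nf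
      _ ≤ l ^ (s - a) * x ^ a := by
        gcongr
      _ ≤ _ := le_add_of_nonneg_right (by positivity)
  · calc x ^ s = x ^ (s - b) * x ^ b := by rw [← Real.rpow_add hx]; ring_nf
      _ ≤ l ^ (s - b) * x ^ b := by
        gcongr ?_ * _
        exact Real.rpow_le_rpow_of_nonpos hl h (by linarith)
      _ ≤ _ := le_add_of_nonneg_left (by positivity)

theorem Continuous.integrable_abs_rpow {d : ℕ} {w : EuclideanSpace ℝ (Fin d) → ℝ}
    (hw : Continuous w) (hcw : HasCompactSupport w) {t : ℝ} (ht : 0 < t) :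
    Integrable fun x => |w x| ^ t := by
  refine Continuous.integrable_of_hasCompactSupport ?_ ?_
  · exact hw.abs.rpow_const fun _ => Or.inr ht.le
  · simpa using hcw.norm.rpow_const ht.ne'

/-- In the plane, `H¹` embeds into every `L^{2(n+1)}`. -/
theorem exists_integral_pow_le_sobolev_two (n : ℕ) :
    ∃ K : ℝ, 0 ≤ K ∧ ∀ w : EuclideanSpace ℝ (Fin 2) → ℝ, ContDiff ℝ 1 w → HasCompactSupport w →
      ∫ x, w x ^ (2 * (n + 1)) ≤
        K * ((∫ x, ‖fderiv ℝ w x‖ ^ 2) + ∫ x, w x ^ 2) ^ (n + 1) := by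
  induction n with
  | zero =>
    refine ⟨1, zero_le_one, fun w _ _ => ?_⟩
    simp only [zero_add, mul_one, pow_one, one_mul]
    exact le_add_of_nonneg_left (by positivity)
  | succ n ih =>
    obtain ⟨K, hK, ih⟩ := ih
    obtain ⟨C, hC, hS⟩ := exists_integral_rpow_le_integral_fderiv_rpow (d := 2) (r := 1) (t := 2)
      two_pos le_rfl two_pos (by norm_num)
    refine ⟨C * (n + 2) ^ 2 * K, by positivity, fun w hw hcw => ?_⟩
    have hw' := hw.continuous_fderiv one_ne_zero
    have hwc := hw.continuous
    have hcw' := hcw.fderiv ℝ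
    have h1 := hS (fun x => w x ^ (n + 2)) (hw.pow _)
      (hcw.comp_left (g := fun y : ℝ => y ^ (n + 2)) (by simp))
    have h2 : ∀ x, ‖fderiv ℝ (fun x => w x ^ (n + 2)) x‖ =
        (n + 2) * (|w x| ^ (n + 1) * ‖fderiv ℝ w x‖) := by
      intro x
      rw [((hw.differentiable one_ne_zero x).hasFDerivAt.pow (n + 2)).fderiv]
      simp [norm_smul, abs_of_nonneg (by positivity : (0 : ℝ) ≤ n + 2), mul_assoc]
    simp only [h2, Real.rpow_one, div_one, Real.rpow_two, sq_abs, integral_const_mul] at h1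
    have h3 : (∫ x, |w x| ^ (n + 1) * ‖fderiv ℝ w x‖) ^ 2 ≤
        (∫ x, w x ^ (2 * (n + 1))) * ∫ x, ‖fderiv ℝ w x‖ ^ 2 := by
      have := integral_mul_le_Lp_mul_Lq_of_nonneg
        (μ := (volume : Measure (EuclideanSpace ℝ (Fin 2)))) Real.HolderConjugate.two_two
        (f := fun x => |w x| ^ (n + 1)) (g := fun x => ‖fderiv ℝ w x‖)
        (.of_forall fun x => by positivity) (.of_forall fun x => by positivity)
        (Continuous.memLp_of_hasCompactSupport (by fun_prop)
          (hcw.comp_left (g := fun y : ℝ => |y| ^ (n + 1)) (by simp)))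
        (Continuous.memLp_of_hasCompactSupport (by fun_prop) hcw'.norm)
      simp only [Real.rpow_two, ← Real.sqrt_eq_rpow] at this
      have h4 := pow_le_pow_left₀ (integral_nonneg fun x => by positivity) this 2
      rw [mul_pow, Real.sq_sqrt (integral_nonneg fun x => by positivity),
        Real.sq_sqrt (integral_nonneg fun x => by positivity)] at h4
      simpa only [← pow_mul, mul_comm (n + 1) 2, Even.pow_abs (even_two_mul _)] using h4
    have hA : 0 ≤ ∫ x, ‖fderiv ℝ w x‖ ^ 2 := by positivity
    have hB : 0 ≤ ∫ x, w x ^ 2 := by positivity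
    set A := ∫ x, ‖fderiv ℝ w x‖ ^ 2
    set B := ∫ x, w x ^ 2
    calc ∫ x, w x ^ (2 * (n + 1 + 1)) = ∫ x, (w x ^ (n + 2)) ^ 2 := by
          congr! 2 with x
          ring
      _ ≤ C * ((n + 2) ^ 2 * (∫ x, |w x| ^ (n + 1) * ‖fderiv ℝ w x‖) ^ 2) := by
          rwa [← mul_pow]
      _ ≤ C * ((n + 2) ^ 2 * ((K * (A + B) ^ (n + 1)) * (A + B))) := by
          gcongr
          refine h3.trans ?_
          gcongr
          · exact ih w hw hcw
          · linarith
      _ = _ := by ring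

/-- A single exponent `t ≥ s` for which `H¹` embeds into `L^t`. -/
theorem exists_sobolev_exponent {d : ℕ} (hd : 2 ≤ d) {s : ℝ} (hs : s * (d - 2) < 2 * d) :
    ∃ t : ℝ, s ≤ t ∧ ∃ K : ℝ, 0 ≤ K ∧ ∀ w : EuclideanSpace ℝ (Fin d) → ℝ,
      ContDiff ℝ 1 w → HasCompactSupport w →
        ∫ x, |w x| ^ t ≤ K * ((∫ x, ‖fderiv ℝ w x‖ ^ 2) + ∫ x, w x ^ 2) ^ (t / 2) := by
  rcases hd.eq_or_lt with rfl | hd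
  · obtain ⟨n, hn⟩ := exists_nat_ge s
    obtain ⟨K, hK, h⟩ := exists_integral_pow_le_sobolev_two n
    have hn0 : (0 : ℝ) ≤ n := n.cast_nonneg
    refine ⟨((2 * (n + 1) : ℕ) : ℝ), ?_, K, hK, fun w hw hcw => ?_⟩
    · push_cast; linarith
    · have : ((2 * (n + 1) : ℕ) : ℝ) / 2 = ((n + 1 : ℕ) : ℝ) := by push_cast; ring
      rw [this]
      simp only [Real.rpow_natCast, Even.pow_abs (even_two_mul _)]
      exact h w hw hcw
  · have hd' : (3 : ℝ) ≤ d := by exact_mod_cast hd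
    have hd2 : (0 : ℝ) < d - 2 := by linarith
    have ht : (0 : ℝ) < 2 * d / (d - 2) := by positivity
    obtain ⟨K, hK, h⟩ := exists_integral_rpow_le_integral_fderiv_rpow (d := d) (r := 2)
      (t := 2 * d / (d - 2)) (by omega) one_le_two ht (by field_simp)
    refine ⟨2 * d / (d - 2), ?_, K, hK, fun w hw hcw => (h w hw hcw).trans ?_⟩
    · rw [le_div_iff₀ hd2]; exact hs.le
    · simp only [Real.rpow_two]
      gcongr
      exact le_add_of_nonneg_right (by positivity)

/-- The subcritical Sobolev embedding `H¹ ⊂ L^s`, `2 ≤ s < 2d/(d-2)`. -/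
theorem exists_integral_rpow_le_sobolev {d : ℕ} (hd : 2 ≤ d) {s : ℝ} (hs : 2 ≤ s)
    (hsd : s * (d - 2) < 2 * d) :
    ∃ K : ℝ, 0 ≤ K ∧ ∀ w : EuclideanSpace ℝ (Fin d) → ℝ, ContDiff ℝ 1 w → HasCompactSupport w →
      ∀ M : ℝ, 0 < M → (∫ x, ‖fderiv ℝ w x‖ ^ 2) + ∫ x, w x ^ 2 ≤ M →
        ∫ x, |w x| ^ s ≤ K * M ^ (s / 2) := by
  obtain ⟨t, hst, K, hK, h⟩ := exists_sobolev_exponent hd hsd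
  refine ⟨1 + K, by positivity, fun w hw hcw M hM hle => ?_⟩
  have ht : 0 < t := by linarith
  have hl : 0 < M ^ (1 / 2 : ℝ) := by positivity
  have h2 := hw.continuous.integrable_abs_rpow hcw (t := 2) two_pos
  have h3 := hw.continuous.integrable_abs_rpow hcw ht
  have hA : 0 ≤ ∫ x, ‖fderiv ℝ w x‖ ^ 2 := by positivity
  calc ∫ x, |w x| ^ s
      ≤ ∫ x, ((M ^ (1 / 2 : ℝ)) ^ (s - 2) * |w x| ^ (2 : ℝ)
          + (M ^ (1 / 2 : ℝ)) ^ (s - t) * |w x| ^ t) :=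
        integral_mono (hw.continuous.integrable_abs_rpow hcw (by linarith))
          ((h2.const_mul _).add (h3.const_mul _))
          fun x => rpow_le_add_rpow_of_mem_Icc (abs_nonneg _) hl two_pos hs hst
    _ = (M ^ (1 / 2 : ℝ)) ^ (s - 2) * (∫ x, w x ^ 2)
          + (M ^ (1 / 2 : ℝ)) ^ (s - t) * ∫ x, |w x| ^ t := by
        rw [integral_add (h2.const_mul _) (h3.const_mul _), integral_const_mul,
          integral_const_mul]
        simp only [Real.rpow_two, sq_abs]
    _ ≤ (M ^ (1 / 2 : ℝ)) ^ (s - 2) * M + (M ^ (1 / 2 : ℝ)) ^ (s - t) * (K * M ^ (t / 2)) := by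
        gcongr
        · linarith
        · refine (h w hw hcw).trans ?_
          gcongr
    _ = (1 + K) * M ^ (s / 2) := by
        have e1 : (M ^ (1 / 2 : ℝ)) ^ (s - 2) * M = M ^ (s / 2) := by
          rw [← Real.rpow_mul hM.le]
          nth_rw 2 [← Real.rpow_one M]
          rw [← Real.rpow_add hM]
          ring_nf
        have e2 : (M ^ (1 / 2 : ℝ)) ^ (s - t) * M ^ (t / 2) = M ^ (s / 2) := by
          rw [← Real.rpow_mul hM.le, ← Real.rpow_add hM]
          ring_nf
        rw [e1, mul_left_comm, e2]
        ring

theorem hasDerivAt_abs_rpow_mul_self {r : ℝ} (hr : 0 < r) (x : ℝ) :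
    HasDerivAt (fun y : ℝ => |y| ^ r * y) ((r + 1) * |x| ^ r) x := by
  rcases eq_or_ne x 0 with rfl | hx
  · rw [hasDerivAt_iff_tendsto_slope_zero]
    have hc : Filter.Tendsto (fun t : ℝ => |t| ^ r) (nhdsWithin 0 {0}ᶜ) (nhds 0) := by
      have : Continuous fun t : ℝ => |t| ^ r := continuous_abs.rpow_const fun _ => Or.inr hr.le
      simpa [Real.zero_rpow hr.ne'] using (this.tendsto 0).mono_left nhdsWithin_le_nhds
    simp only [abs_zero, Real.zero_rpow hr.ne', mul_zero]
    refine hc.congr' ?_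
    filter_upwards [self_mem_nhdsWithin] with t ht
    have : t ≠ 0 := ht
    simp
    field_simp
  · have h := ((hasDerivAt_abs hx).rpow_const (p := r) (Or.inl (abs_ne_zero.2 hx))).mul
      (hasDerivAt_id x)
    refine HasDerivAt.congr_deriv h ?_
    have e : |x| ^ (r - 1) * |x| = |x| ^ r := by
      rw [← Real.rpow_add_one (abs_ne_zero.2 hx)]
      ring_nf
    have e' : (SignType.sign x : ℝ) * x = |x| := by simp
    simp only [id, mul_one]
    linear_combination r * e + r * |x| ^ (r - 1) * e'

/-- Young's inequality with exponents `p/2` and `p/(p-2)` and a small parameter. -/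
theorem exists_sq_mul_rpow_le_add {p : ℝ} (hp : 2 < p) {c ε : ℝ} (hc : 0 ≤ c) (hε : 0 < ε) :
    ∃ C : ℝ, ∀ F M : ℝ, 0 ≤ F → 0 ≤ M →
      c * F ^ 2 * M ^ ((p - 2) / p) ≤ ε * M + C * F ^ p := by
  have hp0 : 0 < p := by linarith
  have hp2 : 0 < p - 2 := by linarith
  refine ⟨(c * (ε ^ ((p - 2) / p))⁻¹) ^ (p / 2), fun F M hF hM => ?_⟩
  set b := c * (ε ^ ((p - 2) / p))⁻¹ with hb
  have hb0 : 0 ≤ b := by positivity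
  have h := Real.geom_mean_le_arith_mean2_weighted (w₁ := 2 / p) (w₂ := (p - 2) / p)
    (p₁ := b ^ (p / 2) * F ^ p) (p₂ := ε * M) (by positivity) (by positivity) (by positivity)
    (by positivity) (by field_simp; ring)
  have e1 : (b ^ (p / 2) * F ^ p) ^ (2 / p) = b * F ^ 2 := by
    rw [Real.mul_rpow (by positivity) (by positivity), ← Real.rpow_mul hb0, ← Real.rpow_mul hF,
      show p / 2 * (2 / p) = 1 by field_simp, show p * (2 / p) = 2 by field_simp, Real.rpow_one,
      Real.rpow_two]
  have e2 : b * ε ^ ((p - 2) / p) = c := by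
    rw [hb]
    field_simp
  rw [e1, Real.mul_rpow hε.le hM] at h
  have h1 : 2 / p * (b ^ (p / 2) * F ^ p) ≤ 1 * (b ^ (p / 2) * F ^ p) := by
    gcongr
    rw [div_le_one hp0]; exact hp.le
  have h2 : (p - 2) / p * (ε * M) ≤ 1 * (ε * M) := by
    gcongr
    rw [div_le_one hp0]; linarith
  calc c * F ^ 2 * M ^ ((p - 2) / p) = b * F ^ 2 * (ε ^ ((p - 2) / p) * M ^ ((p - 2) / p)) := by
        rw [← e2]; ring
    _ ≤ _ := by linarith

theorem norm_fderiv_abs_rpow_half {d : ℕ} {u : EuclideanSpace ℝ (Fin d) → ℝ}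
    (hu : Differentiable ℝ u) {p : ℝ} (hp : 2 < p) (x : EuclideanSpace ℝ (Fin d)) :
    ‖fderiv ℝ (fun y => |u y| ^ (p / 2)) x‖ = p / 2 * (|u x| ^ (p / 2 - 1) * ‖fderiv ℝ u x‖) := by
  have h := (hasDerivAt_abs_rpow (u x) (p := p / 2) (by linarith)).comp_hasFDerivAt x
    (hu x).hasFDerivAt
  have h' : fderiv ℝ (fun y => |u y| ^ (p / 2)) x = _ := h.fderiv
  have e : |u x| ^ (p / 2 - 2) * |u x| = |u x| ^ (p / 2 - 1) := by
    rcases eq_or_ne (u x) 0 with h0 | h0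
    · rw [h0, abs_zero, mul_zero, Real.zero_rpow (by linarith)]
    · rw [← Real.rpow_add_one (abs_ne_zero.2 h0)]
      ring_nf
  rw [h', norm_smul, norm_mul, norm_mul, Real.norm_eq_abs, Real.norm_eq_abs, Real.norm_eq_abs,
    abs_of_nonneg (by linarith : 0 ≤ p / 2), Real.abs_rpow_of_nonneg (abs_nonneg _), abs_abs, ← e]
  ring

theorem norm_gradient_eq_norm_fderiv {d : ℕ} (g : EuclideanSpace ℝ (Fin d) → ℝ)
    (x : EuclideanSpace ℝ (Fin d)) : ‖gradient g x‖ = ‖fderiv ℝ g x‖ := by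
  simp [gradient]

/-- Integration by parts moves the derivative from `f` onto `u`, giving a bound by
`‖∇(|u|^{p/2})‖₂²` and a weighted `L²` norm of `f`. -/
theorem drift_integral_le {d : ℕ} {p δ : ℝ} (hp : 2 < p) (hδ : 0 < δ)
    {u f : EuclideanSpace ℝ (Fin d) → ℝ} (hu : ContDiff ℝ 1 u) (hcu : HasCompactSupport u)
    (hf : ContDiff ℝ 1 f) (hcf : HasCompactSupport f) (j : Fin d) :
    p * |∫ x, |u x| ^ (p - 2) * u x * fderiv ℝ f x (EuclideanSpace.single j 1)|
      ≤ δ * (∫ x, ‖fderiv ℝ (fun y => |u y| ^ (p / 2)) x‖ ^ 2)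
        + (p - 1) ^ 2 / δ * ∫ x, f x ^ 2 * |u x| ^ (p - 2) := by
  have hp2 : 0 < p - 2 := by linarith
  have hud := hu.differentiable one_ne_zero
  have hfd := hf.differentiable one_ne_zero
  have hu' := hu.continuous_fderiv one_ne_zero
  have hf' := hf.continuous_fderiv one_ne_zero
  have huc := hu.continuous
  have hfc := hf.continuous
  set e : EuclideanSpace ℝ (Fin d) := EuclideanSpace.single j 1
  have he : ‖e‖ = 1 := by simp [e]
  have hg : ∀ x, HasFDerivAt (fun y => |u y| ^ (p - 2) * u y)
      (((p - 2 + 1) * |u x| ^ (p - 2)) • fderiv ℝ u x) x := fun x =>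
    (hasDerivAt_abs_rpow_mul_self hp2 (u x)).comp_hasFDerivAt x (hud x).hasFDerivAt
  have hpc : Continuous fun x => |u x| ^ (p - 2) := huc.abs.rpow_const fun _ => Or.inr hp2.le
  have hcp : HasCompactSupport fun x => |u x| ^ (p - 2) := by
    simpa using hcu.norm.rpow_const hp2.ne'
  have hI1 : Integrable fun x => fderiv ℝ (fun y => |u y| ^ (p - 2) * u y) x e * f x := by
    simp only [fun x => (hg x).fderiv, smul_apply, smul_eq_mul]
    exact Continuous.integrable_of_hasCompactSupport (by fun_prop) hcf.mul_left
  have hparts := integral_mul_fderiv_eq_neg_fderiv_mul_of_integrable (𝕜 := ℝ)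
    (f := fun y => |u y| ^ (p - 2) * u y) (g := f) (v := e) (μ := volume) hI1
    (Continuous.integrable_of_hasCompactSupport (by fun_prop) hcp.mul_right.mul_right)
    (Continuous.integrable_of_hasCompactSupport (by fun_prop) hcf.mul_left)
    (fun x _ => (hg x).differentiableAt) (fun x _ => hfd x)
  have hv : ContDiff ℝ 1 fun y => |u y| ^ (p / 2) := hu.norm_rpow (by linarith)
  have hcv : HasCompactSupport fun y => |u y| ^ (p / 2) := by
    simpa using hcu.norm.rpow_const (by linarith : p / 2 ≠ 0)
  have hv' := hv.continuous_fderiv one_ne_zero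
  have hJ1 : Integrable fun x => ‖fderiv ℝ (fun y => |u y| ^ (p / 2)) x‖ ^ 2 :=
    Continuous.integrable_of_hasCompactSupport (by fun_prop)
      ((hcv.fderiv ℝ).norm.comp_left (g := fun y : ℝ => y ^ 2) (by simp))
  have hJ2 : Integrable fun x => f x ^ 2 * |u x| ^ (p - 2) :=
    Continuous.integrable_of_hasCompactSupport (by fun_prop) hcp.mul_left
  rw [hparts, abs_neg]
  calc p * |∫ x, fderiv ℝ (fun y => |u y| ^ (p - 2) * u y) x e * f x|
      ≤ p * ∫ x, |fderiv ℝ (fun y => |u y| ^ (p - 2) * u y) x e * f x| := by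
        gcongr
        exact abs_integral_le_integral_abs
    _ = ∫ x, p * |fderiv ℝ (fun y => |u y| ^ (p - 2) * u y) x e * f x| := by
        rw [integral_const_mul]
    _ ≤ ∫ x, (δ * ‖fderiv ℝ (fun y => |u y| ^ (p / 2)) x‖ ^ 2
          + (p - 1) ^ 2 / δ * (f x ^ 2 * |u x| ^ (p - 2))) := by
        refine integral_mono (hI1.abs.const_mul _) ((hJ1.const_mul _).add (hJ2.const_mul _))
          fun x => ?_
        have hsq : |u x| ^ (p - 2) = (|u x| ^ (p / 2 - 1)) ^ 2 := by
          rw [← Real.rpow_mul_natCast (abs_nonneg _)]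
          push_cast
          ring_nf
        have hle : |fderiv ℝ u x e| ≤ ‖fderiv ℝ u x‖ := by
          simpa [he] using (fderiv ℝ u x).le_opNorm e
        have hp1 : 0 < p - 2 + 1 := by linarith
        simp only [(hg x).fderiv, smul_apply, smul_eq_mul]
        rw [norm_fderiv_abs_rpow_half hud hp, abs_mul, abs_mul, abs_mul, abs_of_pos hp1, hsq,
          abs_of_nonneg (by positivity : 0 ≤ (|u x| ^ (p / 2 - 1)) ^ 2), ← sq_abs (f x)]
        set a := |u x| ^ (p / 2 - 1)
        have ha : 0 ≤ a := by positivity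
        have hfx := abs_nonneg (f x)
        have hmono : p * ((p - 2 + 1) * a ^ 2 * |fderiv ℝ u x e| * |f x|) ≤
            p * ((p - 2 + 1) * a ^ 2 * ‖fderiv ℝ u x‖ * |f x|) := by
          gcongr
        refine hmono.trans ?_
        have hnn : 0 ≤ (δ * (p / 2 * (a * ‖fderiv ℝ u x‖)) - (p - 1) * (|f x| * a)) ^ 2 / δ := by
          positivity
        have hex : (δ * (p / 2 * (a * ‖fderiv ℝ u x‖)) - (p - 1) * (|f x| * a)) ^ 2 / δ =
            δ * (p / 2 * (a * ‖fderiv ℝ u x‖)) ^ 2 + (p - 1) ^ 2 / δ * (|f x| ^ 2 * a ^ 2)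
              - p * ((p - 2 + 1) * a ^ 2 * ‖fderiv ℝ u x‖ * |f x|) := by
          field_simp
          ring
        linarith
    _ = _ := by
        rw [integral_add (hJ1.const_mul _) (hJ2.const_mul _), integral_const_mul,
          integral_const_mul]

theorem integral_sq_mul_rpow_le {d : ℕ} {p q : ℝ} (hp : 2 < p) (hq : 2 < q)
    {u f : EuclideanSpace ℝ (Fin d) → ℝ} (hu : Continuous u) (hcu : HasCompactSupport u)
    (hf : Continuous f) (hcf : HasCompactSupport f) :
    ∫ x, f x ^ 2 * |u x| ^ (p - 2) ≤ ((∫ x, |f x| ^ q) ^ (1 / q)) ^ 2 *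
      (∫ x, |u x| ^ ((p - 2) * q / (q - 2))) ^ ((q - 2) / q) := by
  have hp2 : 0 < p - 2 := by linarith
  have hq2 : 0 < q - 2 := by linarith
  have hq0 : 0 < q := by linarith
  have hconj : (q / 2).HolderConjugate (q / (q - 2)) := by
    rw [Real.holderConjugate_iff]
    constructor
    · linarith
    · field_simp
      ring
  have h := integral_mul_le_Lp_mul_Lq_of_nonneg
    (μ := (volume : Measure (EuclideanSpace ℝ (Fin d)))) hconj
    (f := fun x => f x ^ 2) (g := fun x => |u x| ^ (p - 2))
    (.of_forall fun x => by positivity) (.of_forall fun x => by positivity)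
    (Continuous.memLp_of_hasCompactSupport (by fun_prop)
      (hcf.comp_left (g := fun y : ℝ => y ^ 2) (by simp)))
    (Continuous.memLp_of_hasCompactSupport (hu.abs.rpow_const fun _ => Or.inr hp2.le) (by
      simpa using hcu.norm.rpow_const hp2.ne'))
  refine h.trans_eq ?_
  have hI : 0 ≤ ∫ x, |f x| ^ q := by positivity
  have e1 : ∀ x, (f x ^ 2) ^ (q / 2) = |f x| ^ q := fun x => by
    rw [← sq_abs, ← Real.rpow_two, ← Real.rpow_mul (abs_nonneg _)]
    congr 1
    ring
  have e2 : ∀ x, (|u x| ^ (p - 2)) ^ (q / (q - 2)) = |u x| ^ ((p - 2) * q / (q - 2)) := fun x => by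
    rw [← Real.rpow_mul (abs_nonneg _), mul_div_assoc]
  simp only [e1, e2]
  rw [← Real.rpow_mul_natCast hI]
  congr 2
  · push_cast
    field_simp
  · field_simp

/-- For `d ≥ 2`, `p > 2`, `dp/(p+d−2) < q ≤ p` and every `δ > 0` there is a constant
`C_δ`, depending only on `δ`, `d`, `p` and `q`, such that for all `u, f ∈ C_c^∞(ℝ^d)`
and every `j`,
`p |∫ |u|^{p−2} u ∂_j f| ≤ δ ‖∇(|u|^{p/2})‖₂² + δ ‖u‖_p^p + C_δ ‖f‖_q^p`. -/
theorem drift_term_estimate (d : ℕ) (hd : 2 ≤ d) (p q : ℝ) (hp : 2 < p)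
    (hq1 : (d : ℝ) * p / (p + (d : ℝ) - 2) < q) (hq2 : q ≤ p) (δ : ℝ) (hδ : 0 < δ) :
    ∃ C : ℝ,
      ∀ u f : EuclideanSpace ℝ (Fin d) → ℝ,
        ContDiff ℝ (⊤ : ℕ∞) u → HasCompactSupport u →
        ContDiff ℝ (⊤ : ℕ∞) f → HasCompactSupport f →
        ∀ j : Fin d,
          p * |∫ x, |u x| ^ (p - 2) * u x * fderiv ℝ f x (EuclideanSpace.single j 1)|
            ≤ δ * (∫ x, ‖gradient (fun y => |u y| ^ (p / 2)) x‖ ^ 2)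
              + δ * (∫ x, |u x| ^ p)
              + C * ((∫ x, |f x| ^ q) ^ (1 / q)) ^ p := by
  have hd' : (2 : ℝ) ≤ d := by exact_mod_cast hd
  have hp0 : 0 < p := by linarith
  have hp2 : 0 < p - 2 := by linarith
  have hden : 0 < p + (d : ℝ) - 2 := by linarith
  rw [div_lt_iff₀ hden] at hq1
  have hq : 2 < q := by
    by_contra! h
    nlinarith [mul_nonneg (sub_nonneg.2 hd') hp2.le, mul_le_mul_of_nonneg_right h hden.le]
  have hq0 : 0 < q := by linarith
  have hqs : 0 < q - 2 := by linarith
  obtain ⟨K, hK, hS⟩ := exists_integral_rpow_le_sobolev hd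
    (s := 2 * ((p - 2) * q) / (p * (q - 2)))
    (by rw [le_div_iff₀ (by positivity)]; nlinarith)
    (by rw [div_mul_eq_mul_div, div_lt_iff₀ (by positivity)]; nlinarith)
  obtain ⟨C, hC⟩ := exists_sq_mul_rpow_le_add hp
    (c := (p - 1) ^ 2 / (δ / 2) * K ^ ((q - 2) / q)) (ε := δ / 2) (by positivity) (by positivity)
  refine ⟨C, fun u f hu hcu hf hcf j => ?_⟩
  have hu1 : ContDiff ℝ 1 u := hu.of_le (by exact_mod_cast le_top)
  have hf1 : ContDiff ℝ 1 f := hf.of_le (by exact_mod_cast le_top)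
  simp only [norm_gradient_eq_norm_fderiv]
  have hv : ContDiff ℝ 1 fun y => |u y| ^ (p / 2) := hu1.norm_rpow (by linarith)
  have hcv : HasCompactSupport fun y => |u y| ^ (p / 2) := by
    simpa using hcu.norm.rpow_const (by linarith : p / 2 ≠ 0)
  have hdrift := drift_integral_le hp (half_pos hδ) hu1 hcu hf1 hcf j
  have hHolder := integral_sq_mul_rpow_le hp hq hu1.continuous hcu hf1.continuous hcf
  have hA : 0 ≤ ∫ x, ‖fderiv ℝ (fun y => |u y| ^ (p / 2)) x‖ ^ 2 := by positivity
  have hB : 0 ≤ ∫ x, |u x| ^ p := by positivity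
  have hF : 0 ≤ (∫ x, |f x| ^ q) ^ (1 / q) := by positivity
  have hvB : ∫ x, (|u x| ^ (p / 2)) ^ 2 = ∫ x, |u x| ^ p := by
    congr! 2 with x
    rw [← Real.rpow_mul_natCast (abs_nonneg _)]
    push_cast
    ring_nf
  have hvs : ∀ x, |(|u x| ^ (p / 2))| ^ (2 * ((p - 2) * q) / (p * (q - 2))) =
      |u x| ^ ((p - 2) * q / (q - 2)) := fun x => by
    rw [abs_of_nonneg (by positivity), ← Real.rpow_mul (abs_nonneg _)]
    congr 1
    field_simp
  refine le_of_forall_pos_le_add fun η hη => ?_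
  have hM := hS _ hv hcv
    ((∫ x, ‖fderiv ℝ (fun y => |u y| ^ (p / 2)) x‖ ^ 2) + (∫ x, |u x| ^ p) + 2 * η / δ)
    (by positivity) (by rw [hvB]; exact le_add_of_nonneg_right (by positivity))
  simp only [hvs] at hM
  set A := ∫ x, ‖fderiv ℝ (fun y => |u y| ^ (p / 2)) x‖ ^ 2
  set B := ∫ x, |u x| ^ p
  set F := (∫ x, |f x| ^ q) ^ (1 / q)
  set M := A + B + 2 * η / δ with hMdef
  have hM0 : 0 < M := by positivity
  have hpow : (∫ x, |u x| ^ ((p - 2) * q / (q - 2))) ^ ((q - 2) / q) ≤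
      K ^ ((q - 2) / q) * M ^ ((p - 2) / p) := by
    refine (Real.rpow_le_rpow (by positivity) hM (by positivity)).trans_eq ?_
    rw [Real.mul_rpow hK (by positivity), ← Real.rpow_mul hM0.le]
    congr 2
    field_simp
  have hmain : (p - 1) ^ 2 / (δ / 2) * ∫ x, f x ^ 2 * |u x| ^ (p - 2) ≤
      δ / 2 * M + C * F ^ p := by
    refine le_trans ?_ (hC F M hF hM0.le)
    calc (p - 1) ^ 2 / (δ / 2) * ∫ x, f x ^ 2 * |u x| ^ (p - 2)
        ≤ (p - 1) ^ 2 / (δ / 2) * (F ^ 2 * (K ^ ((q - 2) / q) * M ^ ((p - 2) / p))) := by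
          gcongr
          exact hHolder.trans (by gcongr)
      _ = _ := by ring
  have hδM : δ / 2 * M = δ / 2 * A + δ / 2 * B + η := by
    rw [hMdef]
    field_simp
  have hBδ : δ / 2 * B ≤ δ * B := by nlinarith
  linarith
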